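/- arXiv:1905.08000 — 2 statements merged into one kernel-verified Lean document; each statement's English description precedes it below -/
import Mathlib

section
/- Let q ≥ 2 and let N^q be the free two-step nilpotent complex Lie algebra on q generators u₁,…,u_q, with derived subalgebra V = ⁅N^q, N^q⁆. For any subspaces I and J of V (which are automatically Lie ideals of N^q), the quotient Lie algebras N^q/I and N^q/J are isomorphic as complex Lie algebras if and only if there exists a Lie algebra automorphism θ of N^q such that θ(I) = J. -/
/-- The free two-step nilpotent complex Lie algebra on `q` generators: the quotient of the
free Lie algebra on `Fin q` by the third term `⁅L,⁅L,L⁆⁆` of its lower central series. -/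
abbrev FreeTwoStepNilpotent (q : ℕ) : Type :=
  FreeLieAlgebra ℂ (Fin q) ⧸
    (LieModule.lowerCentralSeries ℂ (FreeLieAlgebra ℂ (Fin q)) (FreeLieAlgebra ℂ (Fin q)) 2 :
      LieIdeal ℂ (FreeLieAlgebra ℂ (Fin q)))

section Helpers

variable {R L L' : Type*} [CommRing R] [LieRing L] [LieAlgebra R L] [LieRing L'] [LieAlgebra R L']

/-- Quotient map as a Lie algebra hom. -/
def mkHom (I : LieIdeal R L) : L →ₗ⁅R⁆ L ⧸ I :=
  { (LieSubmodule.Quotient.mk' I : L →ₗ[R] L ⧸ I) with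
    map_lie' := fun {x y} => LieSubmodule.Quotient.mk_bracket I x y }

theorem mkHom_surjective (I : LieIdeal R L) : Function.Surjective (mkHom I) :=
  LieSubmodule.Quotient.surjective_mk' I

theorem mkHom_eq_zero (I : LieIdeal R L) {x : L} : mkHom I x = 0 ↔ x ∈ I :=
  LieSubmodule.Quotient.mk_eq_zero (N := I)

/-- Descend a Lie algebra hom to a quotient. -/
def liftHom (I : LieIdeal R L) (f : L →ₗ⁅R⁆ L') (h : ∀ x ∈ I, f x = 0) : L ⧸ I →ₗ⁅R⁆ L' :=
  { (I.toSubmodule.liftQ (f : L →ₗ[R] L') (fun x hx => h x hx) : (L ⧸ I) →ₗ[R] L') with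
    map_lie' := by
      intro x y
      obtain ⟨x, rfl⟩ := mkHom_surjective I x
      obtain ⟨y, rfl⟩ := mkHom_surjective I y
      rw [← LieHom.map_lie]
      exact LieHom.map_lie f x y }

theorem liftHom_mk (I : LieIdeal R L) (f : L →ₗ⁅R⁆ L') (h : ∀ x ∈ I, f x = 0) (x : L) :
    liftHom I f h (mkHom I x) = f x := rfl

theorem derived_central (hc : ∀ x y z : L, ⁅x, ⁅y, z⁆⁆ = 0) (x v : L)
    (hv : v ∈ LieAlgebra.derivedSeries R L 1) : ⁅x, v⁆ = 0 := by
  have h : LieAlgebra.derivedSeries R L 1 ≤ LieAlgebra.center R L := by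
    simp only [LieAlgebra.derivedSeriesOfIdeal_succ,
      LieAlgebra.derivedSeriesOfIdeal_zero]
    rw [LieSubmodule.lie_le_iff]
    intro y _ z _
    rw [LieModule.mem_maxTrivSubmodule]
    intro w
    exact hc w y z
  exact (LieModule.mem_maxTrivSubmodule (R := R) (L := L) (M := L) v).1 (h hv) x

theorem fix_derived (hc : ∀ x y z : L, ⁅x, ⁅y, z⁆⁆ = 0) (e : L →ₗ⁅R⁆ L)
    (he : ∀ x, e x - x ∈ LieAlgebra.derivedSeries R L 1) (v : L)
    (hv : v ∈ LieAlgebra.derivedSeries R L 1) : e v = v := by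
  have hv' : v ∈ Submodule.span R {m : L | ∃ x ∈ (⊤ : LieIdeal R L), ∃ n ∈ (⊤ : LieIdeal R L), ⁅x, n⁆ = m} := by
    rw [← LieSubmodule.lieIdeal_oper_eq_linear_span']
    exact hv
  induction hv' using Submodule.span_induction with
  | mem m hm =>
    obtain ⟨x, _, y, _, rfl⟩ := hm
    have h1 := derived_central hc (e x) _ (he y)
    have h2 := derived_central hc y _ (he x)
    rw [lie_sub, sub_eq_zero] at h1
    rw [lie_sub, sub_eq_zero] at h2
    rw [LieHom.map_lie, h1, ← lie_skew, h2, lie_skew]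
  | zero => simp
  | add a b ha hb iha ihb =>
    rw [← LieSubmodule.lieIdeal_oper_eq_linear_span'] at ha hb
    rw [map_add, iha ha, ihb hb]
  | smul r a ha iha =>
    rw [← LieSubmodule.lieIdeal_oper_eq_linear_span'] at ha
    rw [map_smul, iha ha]

theorem bij_of_unipotent (hc : ∀ x y z : L, ⁅x, ⁅y, z⁆⁆ = 0) (e : L →ₗ⁅R⁆ L)
    (he : ∀ x, e x - x ∈ LieAlgebra.derivedSeries R L 1) : Function.Bijective e := by
  constructor
  · rw [injective_iff_map_eq_zero]
    intro x hx
    have h := he x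
    rw [hx, zero_sub] at h
    have h' := fix_derived hc e he _ h
    rw [map_neg, hx] at h'
    simpa using h'.symm
  · intro y
    refine ⟨y - (e y - y), ?_⟩
    rw [map_sub, fix_derived hc e he _ (he y)]
    abel

theorem quot_equiv_of_map (I J : LieIdeal R L) (θ : L ≃ₗ⁅R⁆ L)
    (h : LieIdeal.map θ.toLieHom I = J) : Nonempty ((L ⧸ I) ≃ₗ⁅R⁆ (L ⧸ J)) := by
  have h1 : ∀ x ∈ I, θ x ∈ J := fun x hx => h ▸ LieIdeal.mem_map (f := θ.toLieHom) hx
  have h2 : ∀ y ∈ J, θ.symm y ∈ I := by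
    intro y hy
    rw [← h] at hy
    obtain ⟨x, hx⟩ := LieIdeal.mem_map_of_surjective (f := θ.toLieHom) θ.surjective hy
    have : θ.symm y = x := by
      rw [← hx]; exact θ.symm_apply_apply _
    rw [this]; exact x.2
  let F : (L ⧸ I) →ₗ⁅R⁆ (L ⧸ J) := liftHom I ((mkHom J).comp θ.toLieHom)
    (fun x hx => (mkHom_eq_zero J).2 (h1 x hx))
  let G : (L ⧸ J) →ₗ⁅R⁆ (L ⧸ I) := liftHom J ((mkHom I).comp θ.symm.toLieHom)
    (fun x hx => (mkHom_eq_zero I).2 (h2 x hx))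
  refine ⟨{ F with invFun := G, left_inv := ?_, right_inv := ?_ }⟩
  · intro x
    obtain ⟨x, rfl⟩ := mkHom_surjective I x
    exact congrArg (mkHom I) (θ.symm_apply_apply x)
  · intro x
    obtain ⟨x, rfl⟩ := mkHom_surjective J x
    exact congrArg (mkHom J) (θ.apply_symm_apply x)

theorem exists_aut (hc : ∀ x y z : L, ⁅x, ⁅y, z⁆⁆ = 0) (I J : LieIdeal R L)
    (hI : I ≤ LieAlgebra.derivedSeries R L 1) (hJ : J ≤ LieAlgebra.derivedSeries R L 1)
    (hlift : ∀ (K : LieIdeal R L) (p : L →ₗ⁅R⁆ L ⧸ K), ∃ f : L →ₗ⁅R⁆ L, ∀ x, mkHom K (f x) = p x)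
    (φ : (L ⧸ I) ≃ₗ⁅R⁆ (L ⧸ J)) :
    ∃ θ : L ≃ₗ⁅R⁆ L, LieIdeal.map θ.toLieHom I = J := by
  obtain ⟨f, hf⟩ := hlift J (φ.toLieHom.comp (mkHom I))
  obtain ⟨g, hg⟩ := hlift I (φ.symm.toLieHom.comp (mkHom J))
  have hf' : ∀ x, mkHom J (f x) = φ (mkHom I x) := hf
  have hg' : ∀ x, mkHom I (g x) = φ.symm (mkHom J x) := hg
  have b1 : Function.Bijective (g.comp f) := by
    refine bij_of_unipotent hc _ fun x => hI ((mkHom_eq_zero I).1 ?_)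
    rw [map_sub, LieHom.comp_apply, hg', hf', LieEquiv.symm_apply_apply, sub_self]
  have b2 : Function.Bijective (f.comp g) := by
    refine bij_of_unipotent hc _ fun x => hJ ((mkHom_eq_zero J).1 ?_)
    rw [map_sub, LieHom.comp_apply, hf', hg', LieEquiv.apply_symm_apply, sub_self]
  have bf : Function.Bijective f := by
    rw [LieHom.coe_comp] at b1 b2
    exact ⟨b1.1.of_comp, b2.2.of_comp⟩
  refine ⟨LieEquiv.ofBijective f bf, ?_⟩
  apply LieIdeal.map_of_image
  ext y
  constructor
  · rintro ⟨x, hx, rfl⟩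
    refine (mkHom_eq_zero J).1 ((hf' x).trans ?_)
    rw [(mkHom_eq_zero I).2 hx, map_zero]
  · intro hy
    obtain ⟨x, rfl⟩ := bf.2 y
    refine ⟨x, (mkHom_eq_zero I).1 ?_, rfl⟩
    have h := (mkHom_eq_zero J).2 hy
    rw [hf'] at h
    exact φ.injective (h.trans (map_zero φ).symm)

end Helpers

theorem free_central (q : ℕ) (x y z : FreeTwoStepNilpotent q) : ⁅x, ⁅y, z⁆⁆ = 0 := by
  obtain ⟨x, rfl⟩ := mkHom_surjective _ x
  obtain ⟨y, rfl⟩ := mkHom_surjective _ y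
  obtain ⟨z, rfl⟩ := mkHom_surjective _ z
  rw [← LieHom.map_lie, ← LieHom.map_lie, mkHom_eq_zero]
  exact LieSubmodule.lie_mem_lie (LieSubmodule.mem_top x)
    (LieSubmodule.lie_mem_lie (LieSubmodule.mem_top y) (LieSubmodule.mem_top z))

theorem kills_lcs {R L L' : Type*} [CommRing R] [LieRing L] [LieAlgebra R L] [LieRing L']
    [LieAlgebra R L'] (hc : ∀ x y z : L', ⁅x, ⁅y, z⁆⁆ = 0) (f : L →ₗ⁅R⁆ L') :
    ∀ x ∈ (LieModule.lowerCentralSeries R L L 2 : LieIdeal R L), f x = 0 := by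
  have h1 : (LieModule.lowerCentralSeries R L L 1 : LieIdeal R L) ≤
      LieIdeal.comap f (LieAlgebra.center R L') := by
    rw [LieModule.lowerCentralSeries_succ, LieSubmodule.lie_le_iff]
    intro y _ z _
    rw [LieIdeal.mem_comap, LieModule.mem_maxTrivSubmodule]
    intro w
    rw [LieHom.map_lie]
    exact hc _ _ _
  have h2 : (LieModule.lowerCentralSeries R L L 2 : LieIdeal R L) ≤ f.ker := by
    rw [LieModule.lowerCentralSeries_succ, LieSubmodule.lie_le_iff]
    intro y _ z hz
    rw [LieHom.mem_ker, LieHom.map_lie]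
    have := h1 hz
    rw [LieIdeal.mem_comap, LieModule.mem_maxTrivSubmodule] at this
    exact this _
  exact fun x hx => LieHom.mem_ker.1 (h2 hx)

theorem free_lift (q : ℕ) (K : LieIdeal ℂ (FreeTwoStepNilpotent q))
    (p : FreeTwoStepNilpotent q →ₗ⁅ℂ⁆ FreeTwoStepNilpotent q ⧸ K) :
    ∃ f : FreeTwoStepNilpotent q →ₗ⁅ℂ⁆ FreeTwoStepNilpotent q, ∀ x, mkHom K (f x) = p x := by
  choose s hs using mkHom_surjective K
  let F : FreeLieAlgebra ℂ (Fin q) →ₗ⁅ℂ⁆ FreeTwoStepNilpotent q :=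
    FreeLieAlgebra.lift ℂ fun i => s (p (mkHom _ (FreeLieAlgebra.of ℂ i)))
  refine ⟨liftHom _ F (kills_lcs (free_central q) F), ?_⟩
  have key : (mkHom K).comp F = p.comp (mkHom _) := by
    apply FreeLieAlgebra.hom_ext
    intro i
    simp only [LieHom.comp_apply, F, FreeLieAlgebra.lift_of_apply, hs]
  intro x
  obtain ⟨x, rfl⟩ := mkHom_surjective _ x
  rw [liftHom_mk]
  exact LieHom.congr_fun key x


/-- For subspaces (equivalently, Lie ideals) `I`, `J` of the derived subalgebra
`V = ⁅N^q, N^q⁆` of the free two-step nilpotent complex Lie algebra `N^q` (`q ≥ 2`), the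
quotients `N^q/I` and `N^q/J` are isomorphic iff some automorphism `θ` of `N^q` maps `I`
onto `J`. -/
theorem stmt0 (q : ℕ) (hq : 2 ≤ q)
    (I J : LieIdeal ℂ (FreeTwoStepNilpotent q))
    (hI : I ≤ LieAlgebra.derivedSeries ℂ (FreeTwoStepNilpotent q) 1)
    (hJ : J ≤ LieAlgebra.derivedSeries ℂ (FreeTwoStepNilpotent q) 1) :
    Nonempty ((FreeTwoStepNilpotent q ⧸ I) ≃ₗ⁅ℂ⁆ (FreeTwoStepNilpotent q ⧸ J)) ↔
      ∃ θ : FreeTwoStepNilpotent q ≃ₗ⁅ℂ⁆ FreeTwoStepNilpotent q,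
        LieIdeal.map θ.toLieHom I = J := by

  constructor
  · rintro ⟨φ⟩
    exact exists_aut (free_central q) I J hI hJ (free_lift q) φ
  · rintro ⟨θ, h⟩
    exact quot_equiv_of_map I J θ h
end

section
/- Let N be a finite-dimensional complex Lie algebra which is two-step nilpotent, i.e. ⁅N,⁅N,N⁆⁆ = 0 and ⁅N,N⁆ ≠ 0, and which is indecomposable. Let n = dim_ℂ N and let p = dim_ℂ Z(N), where Z(N) is the center of N. Then 1 ≤ p and, as real numbers, p ≤ n + 1/2 − √(2n + 1/4). -/
/-- A finite-dimensional complex Lie algebra is decomposable if it is the direct sum of two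
nonzero Lie ideals. -/
def LieDecomposable (N : Type) [LieRing N] [LieAlgebra ℂ N] : Prop :=
  ∃ I₁ I₂ : LieIdeal ℂ N, I₁ ≠ ⊥ ∧ I₂ ≠ ⊥ ∧ I₁ ⊓ I₂ = ⊥ ∧ I₁ ⊔ I₂ = ⊤

theorem bracket_mem_span {N : Type} [LieRing N] [LieAlgebra ℂ N] {q : ℕ} (b : Fin q → N)
    (S : Submodule ℂ N) (hS : ∀ i j : Fin q, j < i → ⁅b i, b j⁆ ∈ S)
    (x y : N) (hx : x ∈ Submodule.span ℂ (Set.range b))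
    (hy : y ∈ Submodule.span ℂ (Set.range b)) : ⁅x, y⁆ ∈ S := by
  have hb : ∀ i j, ⁅b i, b j⁆ ∈ S := by
    intro i j
    rcases lt_trichotomy i j with h | h | h
    · rw [← lie_skew]
      exact S.neg_mem (hS _ _ h)
    · subst h
      simp
    · exact hS _ _ h
  induction hx using Submodule.span_induction with
  | mem x hx =>
    obtain ⟨i, rfl⟩ := hx
    induction hy using Submodule.span_induction with
    | mem y hy =>
      obtain ⟨j, rfl⟩ := hy
      exact hb i j
    | zero => simp
    | add u v _ _ hu hv =>
      rw [lie_add]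
      exact S.add_mem hu hv
    | smul a u _ hu =>
      rw [lie_smul]
      exact S.smul_mem _ hu
  | zero => simp
  | add u v _ _ hu hv =>
    rw [add_lie]
    exact S.add_mem hu hv
  | smul a u _ hu =>
    rw [smul_lie]
    exact S.smul_mem _ hu

theorem center_le_of_indec {N : Type} [LieRing N] [LieAlgebra ℂ N]
    (hnab : ∃ x y : N, ⁅x, y⁆ ≠ 0) (hind : ¬ LieDecomposable N)
    (S : Submodule ℂ N) (hS : ∀ x y : N, ⁅x, y⁆ ∈ S) (z : N) (hz : ∀ x : N, ⁅x, z⁆ = 0) :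
    z ∈ S := by
  by_contra hzS
  have hz0 : z ≠ 0 := by
    rintro rfl
    exact hzS S.zero_mem
  have hd : Disjoint S (Submodule.span ℂ {z}) := by
    rw [Submodule.disjoint_span_singleton' hz0]
    exact hzS
  obtain ⟨H, hSH, hH⟩ := hd.exists_isCompl
  apply hind
  let I₁ : LieIdeal ℂ N :=
    { Submodule.span ℂ {z} with
      lie_mem := by
        intro x m hm
        obtain ⟨a, rfl⟩ := Submodule.mem_span_singleton.1 hm
        rw [lie_smul, hz, smul_zero]
        exact Submodule.zero_mem _ }
  let I₂ : LieIdeal ℂ N :=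
    { H with
      lie_mem := by
        intro x m _
        exact hSH (hS x m) }
  have h1 : I₁.toSubmodule = Submodule.span ℂ {z} := rfl
  have h2 : I₂.toSubmodule = H := rfl
  refine ⟨I₁, I₂, ?_, ?_, ?_, ?_⟩
  · intro h
    apply hz0
    have : z ∈ I₁ := Submodule.mem_span_singleton_self (R := ℂ) z
    rw [h] at this
    simpa using this
  · intro h
    obtain ⟨x, y, hxy⟩ := hnab
    apply hxy
    have : ⁅x, y⁆ ∈ I₂ := hSH (hS x y)
    rw [h] at this
    simpa using this
  · rw [← LieSubmodule.toSubmodule_inj, LieSubmodule.inf_toSubmodule, h1, h2]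
    simpa [inf_comm] using hH.inf_eq_bot
  · rw [← LieSubmodule.toSubmodule_inj, LieSubmodule.sup_toSubmodule, h1, h2]
    simpa [sup_comm] using hH.sup_eq_top

/-- For an indecomposable two-step nilpotent finite-dimensional complex Lie algebra `N` of
dimension `n` with center of dimension `p`, one has `1 ≤ p ≤ n + 1/2 − √(2n + 1/4)`. -/
theorem stmt2 (N : Type) [LieRing N] [LieAlgebra ℂ N] [FiniteDimensional ℂ N]
    (htwo : ∀ x y z : N, ⁅x, ⁅y, z⁆⁆ = 0) (hnab : ∃ x y : N, ⁅x, y⁆ ≠ 0)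
    (hind : ¬ LieDecomposable N)
    (n p : ℕ) (hn : n = Module.finrank ℂ N)
    (hp : p = Module.finrank ℂ (LieAlgebra.center ℂ N)) :
    1 ≤ p ∧ (p : ℝ) ≤ (n : ℝ) + 1 / 2 - Real.sqrt (2 * (n : ℝ) + 1 / 4) := by
  have hmem : ∀ z : N, z ∈ LieAlgebra.center ℂ N ↔ ∀ x : N, ⁅x, z⁆ = 0 := fun z =>
    LieModule.mem_maxTrivSubmodule (R := ℂ) (L := N) (M := N) z
  constructor
  · obtain ⟨x, y, hxy⟩ := hnab
    have : Nontrivial (LieAlgebra.center ℂ N) :=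
      ⟨⟨⁅x, y⁆, (hmem _).2 fun w => htwo w x y⟩, 0, fun h => hxy (congrArg Subtype.val h)⟩
    rw [hp]
    exact Module.finrank_pos
  obtain ⟨C, hC⟩ := Submodule.exists_isCompl (LieAlgebra.center ℂ N).toSubmodule
  have hdim : p + Module.finrank ℂ C = n := by
    rw [hp, hn]
    exact Submodule.finrank_add_eq_of_isCompl hC
  obtain ⟨q, hq⟩ : ∃ q, q = Module.finrank ℂ C := ⟨_, rfl⟩
  let b : Fin q → N := fun i => (Module.finBasisOfFinrankEq ℂ C hq.symm i : N)
  have hbC : Submodule.span ℂ (Set.range b) = C := by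
    have h := (Module.finBasisOfFinrankEq ℂ C hq.symm).span_eq
    have h' := congrArg (Submodule.map C.subtype) h
    rw [Submodule.map_span, ← Set.range_comp, Submodule.map_top, Submodule.range_subtype] at h'
    exact h'
  let f : (Σ i : Fin q, Fin i) → N := fun s => ⁅b s.1, b ⟨s.2, s.2.2.trans s.1.2⟩⁆
  let S := Submodule.span ℂ (Set.range f)
  have hS : ∀ i j : Fin q, j < i → ⁅b i, b j⁆ ∈ S := fun i j h =>
    Submodule.subset_span ⟨⟨i, ⟨j, h⟩⟩, rfl⟩
  have hSall : ∀ x y : N, ⁅x, y⁆ ∈ S := by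
    intro x y
    have dec : ∀ x : N, ∃ z c, (∀ w : N, ⁅w, z⁆ = 0) ∧ c ∈ C ∧ z + c = x := by
      intro x
      have hx : x ∈ (LieAlgebra.center ℂ N).toSubmodule ⊔ C := by
        rw [hC.sup_eq_top]
        trivial
      obtain ⟨z, hz, c, hc, h⟩ := Submodule.mem_sup.1 hx
      exact ⟨z, c, (hmem z).1 hz, hc, h⟩
    obtain ⟨z, c, hz, hc, rfl⟩ := dec x
    obtain ⟨z', c', hz', hc', rfl⟩ := dec y
    have e : ⁅z + c, z' + c'⁆ = ⁅c, c'⁆ := by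
      rw [lie_add, hz', add_lie, ← lie_skew z c', hz]
      simp
    rw [e]
    exact bracket_mem_span b S hS c c' (hbC ▸ hc) (hbC ▸ hc')
  have hle : (LieAlgebra.center ℂ N).toSubmodule ≤ S := fun z hz =>
    center_le_of_indec hnab hind S hSall z ((hmem z).1 hz)
  have hpS : p ≤ Fintype.card (Σ i : Fin q, Fin i) := by
    rw [hp]
    exact (Submodule.finrank_mono hle).trans (finrank_range_le_card f)
  have hcard : Fintype.card (Σ i : Fin q, Fin i) * 2 = q * (q - 1) := by
    rw [Fintype.card_sigma, ← Finset.sum_range_id_mul_two]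
    simp [Fin.sum_univ_eq_sum_range (fun i => i)]
  have h2 : 2 * p + q ≤ q * q := by
    rcases q with _ | q
    · simp at hcard
      simp at hpS
      omega
    · simp at hcard hpS ⊢
      nlinarith
  rw [← hq] at hdim
  subst hdim
  have h3 : (2 * p + q : ℝ) ≤ q * q := by exact_mod_cast h2
  have : Real.sqrt (2 * ((p + q : ℕ) : ℝ) + 1 / 4) ≤ q + 1 / 2 := by
    apply Real.sqrt_le_iff.2
    refine ⟨by positivity, ?_⟩
    push_cast
    nlinarith
  push_cast at this ⊢
  linarith
end
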